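/- Let p, q be positive integers with q ≥ p − 1. Then C_{p,q} is an isolation matrix; moreover, the p + q ones on its main diagonal form an isolation set (witnessed by the identity permutation). -/

import Mathlib

/-- The `n × n` circulant 0,1-matrix (as a `Bool`-matrix) whose entry in row `i`,
column `j` is `1` iff `(i - j) mod n < p`.  `Cmat (p+q) p` is the matrix `C_{p,q}`. -/
def Cmat (n p : ℕ) : Matrix (Fin n) (Fin n) Bool :=
  fun i j => decide ((i.val + n - j.val) % n < p)

/-- A 0,1-matrix `C` of size `n × m` is a submatrix of `A_{k,t}`: there are pairwise
distinct `t`-element subsets `A i` of `[k]` indexing the rows and pairwise distinct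
`t`-element subsets `B j` of `[k]` indexing the columns such that `C i j = 1` iff
`A i ∩ B j ≠ ∅`. -/
def IsSubmatrixOfA (k t : ℕ) {n m : ℕ} (C : Matrix (Fin n) (Fin m) Bool) : Prop :=
  ∃ (A : Fin n → Finset (Fin k)) (B : Fin m → Finset (Fin k)),
    Function.Injective A ∧ Function.Injective B ∧
    (∀ i, (A i).card = t) ∧ (∀ j, (B j).card = t) ∧
    (∀ i j, C i j = true ↔ (A i ∩ B j).Nonempty)

/-- Boolean product of 0,1-matrices: `(X·Y)[i][j] = 1` iff there is `l` with
`X[i][l] = 1` and `Y[l][j] = 1`. -/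
def boolMul {n r m : ℕ} (X : Matrix (Fin n) (Fin r) Bool)
    (Y : Matrix (Fin r) (Fin m) Bool) : Matrix (Fin n) (Fin m) Bool :=
  fun i j => decide (∃ l, X i l = true ∧ Y l j = true)

/-- The number of ones in a 0,1-vector. -/
def wt {n : ℕ} (v : Fin n → Bool) : ℕ := (Finset.univ.filter fun a => v a = true).card

/-- A square 0,1-matrix is an isolation matrix: there is a permutation `σ` with
`B[i][σ i] = 1` for all `i`, and no two of these ones lie in a `2 × 2` all-one
submatrix. -/
def IsIsolation {s : ℕ} (B : Matrix (Fin s) (Fin s) Bool) : Prop :=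
  ∃ σ : Equiv.Perm (Fin s), (∀ i, B i (σ i) = true) ∧
    ∀ i j, i ≠ j → ¬(B i (σ j) = true ∧ B j (σ i) = true)

theorem Cmat_eq_true_iff {n p : ℕ} {i j : Fin n} :
    Cmat n p i j = true ↔ (i.val + n - j.val) % n < p := by
  simp [Cmat]

theorem Cmat_diag {n p : ℕ} (hp : 0 < p) (i : Fin n) : Cmat n p i i = true := by
  simpa [Cmat_eq_true_iff] using hp

/-- The two circular distances between distinct indices add up to the full circumference. -/
theorem circular_sub_add_circular_sub {n : ℕ} {i j : Fin n} (hij : i ≠ j) :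
    (i.val + n - j.val) % n + (j.val + n - i.val) % n = n := by
  wlog h : i < j generalizing i j
  · rw [add_comm]
    exact this hij.symm (lt_of_le_of_ne (not_lt.mp h) hij.symm)
  have hlt : i.val < j.val := h
  have hj := j.isLt
  rw [Nat.mod_eq_of_lt (by omega : i.val + n - j.val < n),
    (by omega : j.val + n - i.val = j.val - i.val + n), Nat.add_mod_right,
    Nat.mod_eq_of_lt (by omega)]
  omega

theorem not_Cmat_and_Cmat_symm {n p : ℕ} (h : 2 * p ≤ n + 1) {i j : Fin n} (hij : i ≠ j) :
    ¬(Cmat n p i j = true ∧ Cmat n p j i = true) := by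
  have := circular_sub_add_circular_sub hij
  rw [Cmat_eq_true_iff, Cmat_eq_true_iff]
  omega

/-- for `p, q > 0` with `q ≥ p - 1`, the matrix `C_{p,q}` is an
isolation matrix; moreover its `p + q` diagonal ones form an isolation set,
witnessed by the identity permutation. -/
theorem stmt_16 (p q : ℕ) (hp : 0 < p) (hq : 0 < q) (hqp : p - 1 ≤ q) :
    IsIsolation (Cmat (p + q) p) ∧
    (∀ i, Cmat (p + q) p i i = true) ∧
    (∀ i j : Fin (p + q), i ≠ j →
      ¬(Cmat (p + q) p i j = true ∧ Cmat (p + q) p j i = true)) := by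
  have diag := Cmat_diag (n := p + q) hp
  have offDiag (i j : Fin (p + q)) (hij : i ≠ j) :=
    not_Cmat_and_Cmat_symm (p := p) (by omega) hij
  exact ⟨⟨Equiv.refl _, diag, offDiag⟩, diag, offDiag⟩
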